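/- Let G be a powerful 2-group (i.e., [G,G] ≤ G^4) and let N be a normal subgroup of G with N ≤ G^4. Then N is powerful, i.e., [N,N] ≤ N^4. -/

import Mathlib

/-- For a subgroup `H` of `G`, the subgroup generated by `n`-th powers of elements of `H`. -/
def sgPow {G : Type*} [Group G] (H : Subgroup G) (n : ℕ) : Subgroup G :=
  Subgroup.closure {x | ∃ h ∈ H, h ^ n = x}

section Identities

open scoped commutatorElement

variable {G : Type*} [Group G]

theorem commutator_sq_left (x g : G) : ⁅x ^ 2, g⁆ = ⁅x, ⁅x, g⁆⁆ * ⁅x, g⁆ ^ 2 := by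
  simp only [commutatorElement_def, pow_two]; group

theorem commutator_sq_left' (x g : G) : ⁅x ^ 2, g⁆ = x * ⁅x, g⁆ * x⁻¹ * ⁅x, g⁆ := by
  simp only [commutatorElement_def, pow_two]; group

theorem commutator_sq_right (x g : G) : ⁅x, g ^ 2⁆ = ⁅x, g⁆ * (g * ⁅x, g⁆ * g⁻¹) := by
  simp only [commutatorElement_def, pow_two]; group

theorem commutator_sq_right' (x g : G) : ⁅x, g ^ 2⁆ = ⁅x, g⁆ ^ 2 * ⁅⁅x, g⁆⁻¹, g⁆ := by
  simp only [commutatorElement_def, pow_two]; group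

theorem mul_sq_eq_commutator (x y : G) : (x * y) ^ 2 = x ^ 2 * ⁅x⁻¹, y⁆ * y ^ 2 := by
  simp only [commutatorElement_def, pow_two]; group

theorem commutator_mem_of_mem_closure {S H : Set G} {K : Subgroup G} [hK : K.Normal]
    (hS : ∀ s ∈ S, ∀ h ∈ H, ⁅s, h⁆ ∈ K) {x : G} (hx : x ∈ Subgroup.closure S) :
    ∀ h ∈ H, ⁅x, h⁆ ∈ K := by
  induction hx using Subgroup.closure_induction with
  | mem s hs => exact hS s hs
  | one => intro h _; simp
  | mul x y _ _ hx hy =>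
    intro h hh
    have : ⁅x * y, h⁆ = x * ⁅y, h⁆ * x⁻¹ * ⁅x, h⁆ := by
      simp only [commutatorElement_def]; group
    rw [this]
    exact K.mul_mem (hK.conj_mem _ (hy h hh) _) (hx h hh)
  | inv x _ hx =>
    intro h hh
    have : ⁅x⁻¹, h⁆ = x⁻¹ * ⁅x, h⁆⁻¹ * x⁻¹⁻¹ := by
      simp only [commutatorElement_def]; group
    rw [this]
    exact hK.conj_mem _ (K.inv_mem (hx h hh)) _

theorem commutator_mem_swap {K : Subgroup G} {x y : G} (h : ⁅x, y⁆ ∈ K) : ⁅y, x⁆ ∈ K := by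
  rw [← commutatorElement_inv]; exact K.inv_mem h

theorem commutator_mem_of_mem {K : Subgroup G} [hK : K.Normal] {x : G} (hx : x ∈ K) (g : G) :
    ⁅x, g⁆ ∈ K := by
  rw [commutatorElement_def, mul_assoc, mul_assoc, ← mul_assoc g]
  exact K.mul_mem hx (hK.conj_mem _ (K.inv_mem hx) g)

/-- In a nilpotent group it suffices to prove an inclusion `X ≤ L` modulo `[X, G]`. -/
theorem le_of_le_mod_commutator [Group.IsNilpotent G] (X L : Subgroup G) [L.Normal]
    (h : ∀ K : Subgroup G, K.Normal → L ≤ K → (∀ x ∈ X, ∀ g, ⁅x, g⁆ ∈ K) → X ≤ K) : X ≤ L := by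
  have key : ∀ n, X ≤ L ⊔ (⊤ : Subgroup G).lowerCentralSeries n := by
    intro n
    induction n with
    | zero => simp
    | succ n ih =>
      refine h _ inferInstance le_sup_left fun x hx g => ?_
      have hx' := ih hx
      rw [← SetLike.mem_coe, Subgroup.sup_eq_closure] at hx'
      refine commutator_mem_of_mem_closure (H := Set.univ) ?_ hx' g trivial
      rintro s (hs | hs) g -
      · exact Subgroup.mem_sup_left (commutator_mem_of_mem hs g)
      · exact Subgroup.mem_sup_right (Subgroup.commutator_mem_commutator hs trivial)
  obtain ⟨n, hn⟩ := Subgroup.nilpotent_iff_lowerCentralSeries.1 ‹Group.IsNilpotent G›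
  simpa [hn] using key n

theorem sgPow_normal (H : Subgroup G) (hH : H.Normal) (n : ℕ) : (sgPow H n).Normal := by
  refine ⟨fun x hx g => ?_⟩
  induction hx using Subgroup.closure_induction with
  | mem x hx =>
    obtain ⟨h, hh, rfl⟩ := hx
    exact Subgroup.subset_closure ⟨g * h * g⁻¹, hH.conj_mem _ hh _, conj_pow⟩
  | one => simp
  | mul x y _ _ hx hy => simpa [mul_assoc] using mul_mem hx hy
  | inv x _ hx => simpa [mul_assoc] using inv_mem hx

theorem sgPow_le {H L : Subgroup G} {n : ℕ} : sgPow H n ≤ L ↔ ∀ h ∈ H, h ^ n ∈ L := by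
  rw [sgPow, Subgroup.closure_le]
  exact ⟨fun H' h hh => H' ⟨h, hh, rfl⟩, fun H' _ ⟨h, hh, e⟩ => e ▸ H' h hh⟩

theorem pow_mem_sgPow {H : Subgroup G} (n : ℕ) {h : G} (hh : h ∈ H) : h ^ n ∈ sgPow H n :=
  Subgroup.subset_closure ⟨h, hh, rfl⟩

theorem commutator_sq_mem_left {K : Subgroup G} [K.Normal] {x g : G} (h₁ : ⁅⁅x, g⁆, x⁆ ∈ K)
    (h₂ : ⁅x, g⁆ ^ 2 ∈ K) : ⁅x ^ 2, g⁆ ∈ K := by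
  rw [commutator_sq_left]
  exact K.mul_mem (commutator_mem_swap h₁) h₂

/-- If the commutators of elements of `H` lie in `K`, then squares of products of squares of
elements of `H` lie in `K` as soon as fourth powers do. -/
theorem sq_mem_of_mem_sgPow_two {H K : Subgroup G}
    (h4 : ∀ h ∈ H, h ^ 4 ∈ K) (hc : ∀ v ∈ sgPow H 2, ∀ w ∈ sgPow H 2, ⁅v, w⁆ ∈ K) {v : G}
    (hv : v ∈ sgPow H 2) : v ^ 2 ∈ K := by
  induction hv using Subgroup.closure_induction with
  | mem x hx =>
    obtain ⟨h, hh, rfl⟩ := hx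
    rw [← pow_mul]; exact h4 h hh
  | one => simp
  | mul x y hx hy hx' hy' =>
    rw [mul_sq_eq_commutator]
    exact K.mul_mem (K.mul_mem hx' (hc _ (inv_mem hx) _ hy)) hy'
  | inv x _ hx => rw [inv_pow]; exact K.inv_mem hx

end Identities

section Filtration

open scoped commutatorElement

universe u

/-- A central filtration of `G` modelled on the iterated squares of a powerful `2`-group. -/
structure SquareFiltration (G : Type u) [Group G] where
  /-- The terms of the filtration. -/
  W : ℕ → Subgroup G
  zero : W 0 = ⊤
  succ_le : ∀ i, W (i + 1) ≤ W i
  comm : ∀ {i j x y}, x ∈ W i → y ∈ W j → ⁅x, y⁆ ∈ W (i + j + 2)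
  sq_mem : ∀ {i x}, x ∈ W i → x ^ 2 ∈ W (i + 1)
  root : ∀ {i x}, x ∈ W (i + 1) → ∃ y ∈ W i, y ^ 2 = x

namespace SquareFiltration

variable {G : Type u} [Group G] (F : SquareFiltration G)

theorem antitone : Antitone F.W := antitone_nat_of_succ_le F.succ_le

theorem pow_mem {i n : ℕ} {x : G} (hx : x ∈ F.W i) : x ^ 2 ^ n ∈ F.W (i + n) := by
  induction n with
  | zero => simpa using hx
  | succ n ih => rw [pow_succ, pow_mul]; exact F.sq_mem ih

theorem pow_root {i n : ℕ} {x : G} (hx : x ∈ F.W (i + n)) : ∃ y ∈ F.W i, y ^ 2 ^ n = x := by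
  induction n generalizing x with
  | zero => exact ⟨x, hx, by simp⟩
  | succ n ih =>
    obtain ⟨y, hy, rfl⟩ := F.root (i := i + n) hx
    obtain ⟨z, hz, rfl⟩ := ih hy
    exact ⟨z, hz, by rw [pow_succ, pow_mul]⟩

theorem mem_zero (x : G) : x ∈ F.W 0 := by rw [F.zero]; trivial

theorem normal (i : ℕ) : (F.W i).Normal := by
  refine ⟨fun x hx g => ?_⟩
  have h := F.antitone (show i ≤ 0 + i + 2 by omega) (F.comm (F.mem_zero g) hx)
  have : g * x * g⁻¹ = ⁅g, x⁆ * x := by simp only [commutatorElement_def]; group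
  rw [this]
  exact mul_mem h hx

/-- The image of a filtration in a quotient group. -/
def quotient (N : Subgroup G) [N.Normal] : SquareFiltration (G ⧸ N) where
  W i := (F.W i).map (QuotientGroup.mk' N)
  zero := by rw [F.zero]; exact Subgroup.map_top_of_surjective _ (QuotientGroup.mk'_surjective N)
  succ_le i := Subgroup.map_mono (F.succ_le i)
  comm := by
    rintro i j _ _ ⟨x, hx, rfl⟩ ⟨y, hy, rfl⟩
    exact ⟨⁅x, y⁆, F.comm hx hy, map_commutatorElement _ _ _⟩
  sq_mem := by
    rintro i _ ⟨x, hx, rfl⟩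
    exact ⟨x ^ 2, F.sq_mem hx, map_pow _ _ _⟩
  root := by
    rintro i _ ⟨x, hx, rfl⟩
    obtain ⟨y, hy, rfl⟩ := F.root hx
    exact ⟨_, ⟨y, hy, rfl⟩, (map_pow _ _ _).symm⟩

theorem mk_mem_quotient (N : Subgroup G) [N.Normal] {i : ℕ} {x : G} (hx : x ∈ F.W i) :
    (x : G ⧸ N) ∈ (F.quotient N).W i := ⟨x, hx, rfl⟩

theorem quotient_eq_bot (N : Subgroup G) [N.Normal] {i : ℕ} (h : F.W i ≤ N) :
    (F.quotient N).W i = ⊥ := by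
  change (F.W i).map (QuotientGroup.mk' N) = ⊥
  rw [Subgroup.map_eq_bot_iff, QuotientGroup.ker_mk']
  exact h

theorem commute_of_mem {F : SquareFiltration G} {j : ℕ} (hj : F.W (j + 2) = ⊥) {x : G}
    (hx : x ∈ F.W j) (g : G) : Commute x g := by
  have := F.comm hx (F.mem_zero g)
  rw [add_zero, hj, Subgroup.mem_bot] at this
  exact commutatorElement_eq_one_iff_commute.1 this

/-- An element whose square lies in the last term is an involution times a central element. -/
theorem exists_mul_sq_eq_one {F : SquareFiltration G} {j : ℕ} (hj : F.W (j + 2) = ⊥) {h : G}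
    (hh : h ^ 2 ∈ F.W (j + 1)) : ∃ c ∈ F.W j, ∃ i : G, i ^ 2 = 1 ∧ c * i = h := by
  obtain ⟨c, hc, e⟩ := F.root hh
  refine ⟨c, hc, c⁻¹ * h, ?_, by group⟩
  rw [((commute_of_mem hj hc h).inv_left).mul_pow, inv_pow, e]
  group

/-- If every involution in `W m` commutes with `f`, so does every element of `W m` whose square
lies in the last term. -/
theorem commute_of_sq_mem {F : SquareFiltration G} {j m : ℕ} (hj : F.W (j + 2) = ⊥) {f h : G}
    (H : ∀ i ∈ F.W m, i ^ 2 = 1 → Commute i f) (hm : h ∈ F.W m) (hh : h ^ 2 ∈ F.W (j + 1)) :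
    Commute h f := by
  rcases le_total m j with hmj | hmj
  · obtain ⟨c, hc, i, hi, rfl⟩ := exists_mul_sq_eq_one hj hh
    refine (commute_of_mem hj hc f).mul_left (H i ?_ hi)
    exact (Subgroup.mul_mem_cancel_left _ (F.antitone hmj hc)).1 hm
  · exact commute_of_mem hj (F.antitone hmj hm) f

/-- Induction on the length of the filtration: an element of order dividing `2 ^ n` commutes with
the involutions in `W n`, and any element of `W n` that it inverts is an involution. -/
theorem commute_and_sq_eq_one (k : ℕ) : ∀ {G : Type u} [Group G] (F : SquareFiltration G),
    F.W (k + 1) = ⊥ →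
    (∀ (n : ℕ) (s d : G), s ^ 2 ^ n = 1 → d ∈ F.W n → d ^ 2 = 1 → Commute d s) ∧
    (∀ (n : ℕ) (f h : G), f ^ 2 ^ n = 1 → h ∈ F.W n → f * h * f⁻¹ = h⁻¹ → h ^ 2 = 1) := by
  induction k with
  | zero =>
    intro G _ F hF
    have hc : ∀ x y : G, Commute x y := fun x y =>
      commute_of_mem (j := 0) (le_bot_iff.1 (hF ▸ F.succ_le 1)) (F.mem_zero x) y
    refine ⟨fun _ s d _ _ _ => hc d s, fun _ f h _ _ hfh => ?_⟩
    rw [(hc f h).eq, mul_inv_cancel_right] at hfh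
    rw [pow_two]; nth_rw 1 [hfh]; group
  | succ j ih =>
    intro G _ F hF
    have := F.normal (j + 1)
    obtain ⟨ih₁, ih₂⟩ := ih (F.quotient (F.W (j + 1))) (F.quotient_eq_bot _ le_rfl)
    have sq_mem_last : ∀ (n : ℕ) (f h : G), f ^ 2 ^ n = 1 → h ∈ F.W n →
        f * h * f⁻¹ * h ∈ F.W (j + 1) → h ^ 2 ∈ F.W (j + 1) := by
      intro n f h hf hh hfh
      rw [← QuotientGroup.eq_one_iff] at hfh ⊢
      refine ih₂ n f h ?_ (F.mk_mem_quotient _ hh) (eq_inv_of_mul_eq_one_left hfh)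
      rw [← QuotientGroup.mk_pow, hf]; rfl
    have main : ∀ t m : ℕ, j ≤ m + t → ∀ n ≤ m, ∀ s d : G, s ^ 2 ^ n = 1 → d ∈ F.W m →
        d ^ 2 = 1 → Commute d s := by
      intro t
      induction t with
      | zero =>
        intro m hm n _ s d _ hd _
        exact commute_of_mem hF (F.antitone hm hd) s
      | succ t iht =>
        intro m hm n hn s d hs hd hd2
        have deep : ∀ n ≤ m + 1, ∀ f h : G, f ^ 2 ^ n = 1 → h ∈ F.W (m + 1) →
            h ^ 2 ∈ F.W (j + 1) → Commute h f := fun n hn f h hf hh hh2 =>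
          commute_of_sq_mem hF (fun i hi hi2 => iht (m + 1) (by omega) n hn f i hf hi hi2) hh hh2
        have hz : ⁅d, s⁆ ∈ F.W (j + 1) := by
          rw [← QuotientGroup.eq_one_iff]
          refine (map_commutatorElement (QuotientGroup.mk' _) d s).trans
            (commutatorElement_eq_one_iff_commute.2
              (ih₁ n _ _ ?_ (F.mk_mem_quotient _ (F.antitone hn hd)) ?_))
          · rw [← map_pow, hs, map_one]
          · rw [← map_pow, hd2, map_one]
        obtain ⟨l, rfl⟩ := Nat.exists_eq_add_of_le' hn
        obtain ⟨u, hu, rfl⟩ := F.pow_root hd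
        have step : ∀ q r, q + r = n → ⁅u ^ 2 ^ n, s⁆ = ⁅u ^ 2 ^ r, s ^ 2 ^ q⁆ := by
          intro q
          induction q with
          | zero => rintro r rfl; simp
          | succ q ihq =>
            intro r hr
            have hz' := ihq (r + 1) (by omega)
            have hf : (u ^ 2 ^ r) ^ 2 ^ (q + 2) = 1 := by
              rw [← pow_mul, ← hd2, ← pow_mul, ← pow_add, ← pow_succ]
              congr 2; omega
            have hg : (s ^ 2 ^ q) ^ 2 ^ (r + 1) = 1 := by
              rw [← pow_mul, ← pow_add, show q + (r + 1) = n by omega, hs]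
            have hh := F.comm (F.pow_mem (n := r) hu) (F.pow_mem (n := q) (F.mem_zero s))
            rw [show l + r + (0 + q) + 2 = l + n + 1 by omega] at hh
            rw [pow_succ 2 r, pow_mul, commutator_sq_left'] at hz'
            have hh2 := sq_mem_last (q + 2) _ _ hf (F.antitone (by omega) hh) (hz' ▸ hz)
            have c₁ := deep (q + 2) (by omega) _ _ hf hh hh2
            have c₂ := deep (r + 1) (by omega) _ _ hg hh hh2
            rw [hz', pow_succ 2 q, pow_mul, commutator_sq_right, ← c₁.eq, ← c₂.eq,
              mul_inv_cancel_right, mul_inv_cancel_right]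
        have := step n 0 (add_zero n)
        rw [hs, commutatorElement_one_right] at this
        exact commutatorElement_eq_one_iff_commute.1 this
    have part₁ : ∀ (n : ℕ) (s d : G), s ^ 2 ^ n = 1 → d ∈ F.W n → d ^ 2 = 1 → Commute d s :=
      fun n s d => main j n (by omega) n le_rfl s d
    refine ⟨part₁, fun n f h hf hh hfh => ?_⟩
    have hh2 := sq_mem_last n f h hf hh (by rw [hfh, inv_mul_cancel]; exact one_mem _)
    have c := commute_of_sq_mem hF (fun i hi hi2 => part₁ n f i hf hi hi2) hh hh2
    rw [← c.eq, mul_inv_cancel_right] at hfh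
    rw [pow_two]; nth_rw 1 [hfh]; group

/-- A normal subgroup of exponent `4` inside the second term of the filtration is abelian. -/
theorem commutator_eq_one [Group.IsNilpotent G] {F : SquareFiltration G} {k : ℕ}
    (hF : F.W (k + 1) = ⊥) {N : Subgroup G} [hN : N.Normal] (hN2 : N ≤ F.W 2)
    (h4 : ∀ n ∈ N, n ^ 4 = 1) {x y : G} (hx : x ∈ N) (hy : y ∈ N) : ⁅x, y⁆ = 1 := by
  set M : Set G := {a | a ∈ F.W 1 ∧ a ^ 2 ∈ N} with hM
  have hNM : ∀ n ∈ N, n ∈ M := fun n hn => ⟨F.succ_le 1 (hN2 hn), N.pow_mem hn 2⟩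
  have root : ∀ n ∈ N, ∃ b ∈ M, b ^ 2 = n := by
    intro n hn
    obtain ⟨b, hb, rfl⟩ := F.root (hN2 hn)
    exact ⟨b, ⟨hb, hn⟩, rfl⟩
  have comm_mem : ∀ a ∈ M, ∀ b ∈ M, ⁅a, b⁆ ∈ N := by
    rintro a ⟨ha, ha2⟩ b ⟨-, hb2⟩
    rw [← QuotientGroup.eq_one_iff] at ha2 hb2 ⊢
    refine (map_commutatorElement (QuotientGroup.mk' N) a b).trans
      (commutatorElement_eq_one_iff_commute.2 ((commute_and_sq_eq_one k (F.quotient N)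
        (F.quotient_eq_bot N (hF ▸ bot_le))).1 1 _ _ ?_ (F.mk_mem_quotient N ha) ?_))
    · rw [pow_one, ← map_pow]; exact hb2
    · rw [← map_pow]; exact ha2
  have hS := sgPow_normal N hN 2
  have hSN : sgPow N 2 ≤ N := sgPow_le.2 fun n hn => N.pow_mem hn 2
  have comm_sq : ∀ t i, k ≤ i + t → ∀ x ∈ N, x ∈ F.W (i + 2) → ∀ b ∈ M, ⁅x, b⁆ ∈ sgPow N 2 := by
    intro t
    induction t with
    | zero =>
      intro i hi x _ hx b _
      have := F.antitone (show k + 1 ≤ i + 2 by omega) hx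
      rw [hF, Subgroup.mem_bot] at this
      simp [this]
    | succ t ih =>
      intro i hi x hxN hx b hb
      obtain ⟨a, ha, rfl⟩ := F.root hx
      have haM : a ∈ M := ⟨F.antitone (by omega) ha, hxN⟩
      have he := comm_mem a haM b hb
      exact commutator_sq_mem_left
        (ih (i + 1) (by omega) _ he (F.antitone (by omega) (F.comm ha hb.1)) a haM)
        (pow_mem_sgPow 2 he)
  replace comm_sq : ∀ x ∈ N, ∀ b ∈ M, ⁅x, b⁆ ∈ sgPow N 2 := fun x hx =>
    comm_sq k 0 (by omega) x hx (hN2 hx)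
  set X : Subgroup G := Subgroup.closure {z | ∃ v ∈ sgPow N 2, ∃ b ∈ M, ⁅v, b⁆ = z} with hX
  have memX : ∀ v ∈ sgPow N 2, ∀ b ∈ M, ⁅v, b⁆ ∈ X := fun v hv b hb =>
    Subgroup.subset_closure ⟨v, hv, b, hb, rfl⟩
  have hSM : ∀ v ∈ sgPow N 2, v ∈ M := fun v hv => hNM v (hSN hv)
  have XS : X ≤ ⊥ := by
    refine le_of_le_mod_commutator X ⊥ fun K hK _ hXK => ?_
    have hcomm : ∀ v ∈ sgPow N 2, ∀ n ∈ N, ⁅v, n⁆ ∈ K := by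
      intro v hv n hn
      obtain ⟨b, hb, rfl⟩ := root n hn
      have hvX : v ^ 2 ∈ X := sq_mem_of_mem_sgPow_two
        (fun h hh => by rw [h4 h hh]; exact X.one_mem)
        (fun v hv w hw => memX v hv w (hSM w hw)) hv
      have h₁ := hXK _ hvX b
      rw [commutator_sq_left,
        K.mul_mem_cancel_left (commutator_mem_swap (hXK _ (memX v hv b hb) v))] at h₁
      rw [commutator_sq_right']
      exact K.mul_mem h₁ (hXK _ (X.inv_mem (memX v hv b hb)) b)
    have hsq : ∀ v ∈ sgPow N 2, v ^ 2 ∈ K := fun v hv => sq_mem_of_mem_sgPow_two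
      (fun h hh => by rw [h4 h hh]; exact K.one_mem) (fun v hv w hw => hcomm v hv w (hSN hw)) hv
    rw [hX, Subgroup.closure_le]
    rintro _ ⟨v, hv, b, hb, rfl⟩
    refine commutator_mem_of_mem_closure ?_ hv b hb
    rintro _ ⟨n, hn, rfl⟩ b hb
    have he := comm_sq n hn b hb
    exact commutator_sq_mem_left (hcomm _ he n hn) (hsq _ he)
  have cent : ∀ v ∈ sgPow N 2, ∀ b ∈ M, ⁅v, b⁆ = 1 := fun v hv b hb => XS (memX v hv b hb)
  obtain ⟨b, hb, rfl⟩ := root y hy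
  have he := comm_sq x hx b hb
  have he2 : ⁅x, b⁆ ^ 2 ∈ (⊥ : Subgroup G) := sq_mem_of_mem_sgPow_two
    (fun h hh => h4 h hh) (fun v hv w hw => cent v hv w (hSM w hw)) he
  rw [commutator_sq_right, ← (commutatorElement_eq_one_iff_commute.1 (cent _ he b hb)).eq,
    mul_inv_cancel_right, ← pow_two]
  exact he2

end SquareFiltration

/-- The iterated subgroups of squares of a group. -/
def iterSq (G : Type u) [Group G] : ℕ → Subgroup G
  | 0 => ⊤
  | i + 1 => sgPow (iterSq G i) 2

section Powerful

variable {G : Type u} [Group G]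

theorem iterSq_normal (i : ℕ) : (iterSq G i).Normal := by
  induction i with
  | zero => exact inferInstanceAs (⊤ : Subgroup G).Normal
  | succ i ih => exact sgPow_normal _ ih 2

theorem iterSq_antitone : Antitone (iterSq G) :=
  antitone_nat_of_succ_le fun i => sgPow_le.2 fun _ hh => (iterSq G i).pow_mem hh 2

theorem sq_mem_iterSq {i : ℕ} {x : G} (hx : x ∈ iterSq G i) : x ^ 2 ∈ iterSq G (i + 1) :=
  pow_mem_sgPow 2 hx

theorem sgPow_four_le_iterSq : sgPow (⊤ : Subgroup G) 4 ≤ iterSq G 2 :=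
  sgPow_le.2 fun h _ => by
    rw [show 4 = 2 * 2 from rfl, pow_mul]
    exact sq_mem_iterSq (sq_mem_iterSq (i := 0) trivial)

theorem commutator_mem_iterSq [Group.IsNilpotent G]
    (hG : ⁅(⊤ : Subgroup G), (⊤ : Subgroup G)⁆ ≤ sgPow ⊤ 4) (i : ℕ) :
    ∀ x ∈ iterSq G i, ∀ g, ⁅x, g⁆ ∈ iterSq G (i + 2) := by
  induction i with
  | zero =>
    exact fun x _ g => sgPow_four_le_iterSq (hG (Subgroup.commutator_mem_commutator trivial trivial))
  | succ i ih =>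
    set X : Subgroup G := Subgroup.closure {z | ∃ y ∈ iterSq G (i + 1), ∃ g, ⁅y, g⁆ = z} with hX
    have memX : ∀ y ∈ iterSq G (i + 1), ∀ g, ⁅y, g⁆ ∈ X := fun y hy g =>
      Subgroup.subset_closure ⟨y, hy, g, rfl⟩
    have := iterSq_normal (G := G) (i + 1 + 2)
    suffices X ≤ iterSq G (i + 1 + 2) from fun y hy g => this (memX y hy g)
    refine le_of_le_mod_commutator X _ fun K hK hLK hXK => ?_
    have hXW : X ≤ iterSq G (i + 2) := by
      rw [hX, Subgroup.closure_le]
      rintro _ ⟨y, hy, g, rfl⟩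
      exact ih y (iterSq_antitone (Nat.le_succ i) hy) g
    have hsq : ∀ z ∈ iterSq G (i + 2), z ^ 2 ∈ K := fun z hz => hLK (sq_mem_iterSq hz)
    have hW : ∀ z ∈ iterSq G (i + 2), ∀ g, ⁅z, g⁆ ∈ K := by
      intro z hz g
      refine commutator_mem_of_mem_closure (H := Set.univ) ?_ hz g trivial
      rintro _ ⟨y, hy, rfl⟩ g -
      exact commutator_sq_mem_left (hXK _ (memX y hy g) y) (hsq _ (hXW (memX y hy g)))
    rw [hX, Subgroup.closure_le]
    rintro _ ⟨y, hy, g, rfl⟩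
    refine commutator_mem_of_mem_closure (H := Set.univ) ?_ hy g trivial
    rintro _ ⟨x, hx, rfl⟩ g -
    exact commutator_sq_mem_left (hW _ (ih x hx g) x) (hsq _ (ih x hx g))

theorem commutator_mem_iterSq_add [Group.IsNilpotent G]
    (hG : ⁅(⊤ : Subgroup G), (⊤ : Subgroup G)⁆ ≤ sgPow ⊤ 4) {i j : ℕ} :
    ∀ {x y : G}, x ∈ iterSq G i → y ∈ iterSq G j → ⁅x, y⁆ ∈ iterSq G (i + j + 2) := by
  induction j with
  | zero => exact fun hx _ => commutator_mem_iterSq hG i _ hx _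
  | succ j ih =>
    intro x y hx hy
    have := iterSq_normal (G := G) (i + (j + 1) + 2)
    refine commutator_mem_swap (commutator_mem_of_mem_closure (H := iterSq G i) ?_ hy x hx)
    rintro _ ⟨y, hy, rfl⟩ x hx
    refine commutator_mem_swap ?_
    rw [commutator_sq_right']
    have he := ih hx hy
    exact mul_mem (sq_mem_iterSq he) (iterSq_antitone (by omega)
      (commutator_mem_iterSq hG _ _ (inv_mem he) y))

theorem mk_mul_sq_eq {K : Subgroup G} [hK : K.Normal] {x y : G} (h : ⁅x⁻¹, y⁆ ∈ K) :
    (((x * y) ^ 2 : G) : G ⧸ K) = ((x ^ 2 * y ^ 2 : G) : G ⧸ K) := by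
  rw [← QuotientGroup.eq_one_iff] at h
  rw [mul_sq_eq_commutator, QuotientGroup.mk_mul, QuotientGroup.mk_mul, h, mul_one,
    QuotientGroup.mk_mul]

theorem exists_sq_eq_mod [Group.IsNilpotent G]
    (hG : ⁅(⊤ : Subgroup G), (⊤ : Subgroup G)⁆ ≤ sgPow ⊤ 4) {m : ℕ} {w : G}
    (hw : w ∈ iterSq G (m + 1)) :
    ∃ v ∈ iterSq G m, ((v ^ 2 : G) : G ⧸ iterSq G (m + 2)) = w := by
  have := iterSq_normal (G := G) (m + 2)
  induction hw using Subgroup.closure_induction with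
  | mem x hx =>
    obtain ⟨h, hh, rfl⟩ := hx
    exact ⟨h, hh, rfl⟩
  | one => exact ⟨1, one_mem _, by rw [one_pow]⟩
  | mul x y _ _ hx hy =>
    obtain ⟨v, hv, ev⟩ := hx
    obtain ⟨w, hw, ew⟩ := hy
    refine ⟨v * w, mul_mem hv hw, ?_⟩
    rw [mk_mul_sq_eq (commutator_mem_iterSq hG m _ (inv_mem hv) w), QuotientGroup.mk_mul, ev, ew,
      QuotientGroup.mk_mul]
  | inv x _ hx =>
    obtain ⟨v, hv, ev⟩ := hx
    exact ⟨v⁻¹, inv_mem hv, by rw [inv_pow, QuotientGroup.mk_inv, ev, QuotientGroup.mk_inv]⟩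

theorem exists_sq_eq_mod_add [Group.IsNilpotent G]
    (hG : ⁅(⊤ : Subgroup G), (⊤ : Subgroup G)⁆ ≤ sgPow ⊤ 4) {i : ℕ} {x : G}
    (hx : x ∈ iterSq G (i + 1)) (n : ℕ) :
    ∃ y ∈ iterSq G i, (y ^ 2)⁻¹ * x ∈ iterSq G (i + 1 + n) := by
  induction n with
  | zero => exact ⟨1, one_mem _, by simpa using hx⟩
  | succ n ih =>
    obtain ⟨y, hy, hyx⟩ := ih
    rw [show i + 1 + n = i + n + 1 by omega] at hyx
    obtain ⟨v, hv, hvx⟩ := exists_sq_eq_mod hG hyx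
    have := iterSq_normal (G := G) (i + n + 2)
    refine ⟨y * v, mul_mem hy (iterSq_antitone (Nat.le_add_right i n) hv), ?_⟩
    rw [show i + 1 + (n + 1) = i + n + 2 by omega, ← QuotientGroup.eq, mk_mul_sq_eq
      (iterSq_antitone (by omega) (commutator_mem_iterSq_add hG (inv_mem hy) hv)),
      QuotientGroup.mk_mul, hvx, ← QuotientGroup.mk_mul, mul_inv_cancel_left]

theorem iterSq_succ_lt [Finite G] (hG : IsPGroup 2 G) {i : ℕ} (hi : iterSq G i ≠ ⊥) :
    iterSq G (i + 1) < iterSq G i := by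
  refine lt_of_le_of_ne (iterSq_antitone (Nat.le_succ i)) fun h => hi ?_
  have : Fact (Nat.Prime 2) := ⟨Nat.prime_two⟩
  obtain ⟨n, hn⟩ := IsPGroup.iff_card.1 (hG.to_subgroup (iterSq G i))
  cases n with
  | zero => exact Subgroup.card_eq_one.1 (by simpa using hn)
  | succ n =>
    exfalso
    obtain ⟨H, hH⟩ := Sylow.exists_subgroup_card_pow_prime (G := iterSq G i) 2
      (n := n) (hn ▸ pow_dvd_pow 2 (Nat.le_succ n))
    have hind : H.index = 2 := by
      have := H.card_mul_index
      rw [hH, hn, pow_succ] at this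
      exact Nat.eq_of_mul_eq_mul_left (by positivity) this
    have hle : iterSq G (i + 1) ≤ H.map (iterSq G i).subtype := sgPow_le.2 fun h hh =>
      ⟨⟨h, hh⟩ ^ 2, Subgroup.sq_mem_of_index_two hind _, rfl⟩
    have htop : H = ⊤ := by
      refine eq_top_iff.2 fun x _ => ?_
      obtain ⟨y, hy, e⟩ := hle (h.ge x.2)
      rwa [← Subtype.ext (a2 := x) e]
    rw [htop, Subgroup.index_top] at hind
    omega

theorem exists_iterSq_eq_bot [Finite G] (hG : IsPGroup 2 G) : ∃ k, iterSq G k = ⊥ := by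
  by_contra! h
  exact not_strictAnti_of_wellFoundedLT (iterSq G)
    (strictAnti_nat_of_succ_lt fun i => iterSq_succ_lt hG (h i))

/-- The iterated subgroups of squares of a powerful finite `2`-group form a filtration. -/
def squareFiltration [Finite G] (hG : IsPGroup 2 G)
    (hpow : ⁅(⊤ : Subgroup G), (⊤ : Subgroup G)⁆ ≤ sgPow ⊤ 4) : SquareFiltration G :=
  have : Fact (Nat.Prime 2) := ⟨Nat.prime_two⟩
  have : Group.IsNilpotent G := hG.isNilpotent
  { W := iterSq G
    zero := rfl
    succ_le := fun i => iterSq_antitone (Nat.le_succ i)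
    comm := commutator_mem_iterSq_add hpow
    sq_mem := sq_mem_iterSq
    root := by
      intro i x hx
      obtain ⟨k, hk⟩ := exists_iterSq_eq_bot hG
      obtain ⟨y, hy, h⟩ := exists_sq_eq_mod_add hpow hx k
      have := iterSq_antitone (Nat.le_add_left k (i + 1)) h
      rw [hk, Subgroup.mem_bot] at this
      exact ⟨y, hy, inv_mul_eq_one.1 this⟩ }

end Powerful

end Filtration

/-- if G is a powerful 2-group and N ≤ G^4 is normal in G, then N is
powerful, i.e. [N,N] ≤ N^4. -/
theorem stmt1 {G : Type*} [Group G] [Finite G] (hpG : IsPGroup 2 G)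
    (hpowerful : ⁅(⊤ : Subgroup G), (⊤ : Subgroup G)⁆ ≤ sgPow ⊤ 4)
    (N : Subgroup G) (hN : N.Normal) (hNle : N ≤ sgPow ⊤ 4) :
    ⁅N, N⁆ ≤ sgPow N 4 := by
  have : Fact (Nat.Prime 2) := ⟨Nat.prime_two⟩
  have : Group.IsNilpotent G := hpG.isNilpotent
  have hP := sgPow_normal N hN 4
  obtain ⟨k, hk⟩ := exists_iterSq_eq_bot hpG
  set F := squareFiltration hpG hpowerful
  have hFk : F.W (k + 1) = ⊥ := le_bot_iff.1 ((F.succ_le k).trans hk.le)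
  have hM : (N.map (QuotientGroup.mk' (sgPow N 4))).Normal :=
    hN.map _ (QuotientGroup.mk'_surjective _)
  refine Subgroup.commutator_le.2 fun x hx y hy => ?_
  rw [← QuotientGroup.eq_one_iff]
  refine (map_commutatorElement (QuotientGroup.mk' (sgPow N 4)) x y).trans
    (SquareFiltration.commutator_eq_one (F := F.quotient (sgPow N 4)) (k := k)
      (F.quotient_eq_bot _ (hFk ▸ bot_le)) (N := N.map (QuotientGroup.mk' (sgPow N 4)))
      (Subgroup.map_mono (hNle.trans sgPow_four_le_iterSq)) ?_
      (Subgroup.mem_map_of_mem _ hx) (Subgroup.mem_map_of_mem _ hy))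
  rintro _ ⟨n, hn, rfl⟩
  rw [← map_pow]
  exact (QuotientGroup.eq_one_iff _).2 (pow_mem_sgPow 4 hn)
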